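/- arXiv:1210.3978 — 2 statements merged into one kernel-verified Lean document; each statement's English description precedes it below -/
import Mathlib

section
/- Let D be a finite transitive acyclic digraph on vertex set U, and define u < v iff there is an arc from u to v in D, so that < is a strict partial order on U. Let R be a finite digraph on vertex set S, let w_1, …, w_m be distinct vertices of S, and let W_{D,1}, …, W_{D,m} be pairwise disjoint subsets of U. Then the following are equivalent: (i) there exists an injection γ : S → U such that γ(w_i) ∈ W_{D,i} for each i ∈ [m] and (γ(u), γ(v)) is an arc of D for every arc (u, v) of R; (ii) there exists a function π : S → U such that π(w_i) ∈ W_{D,i} for each i ∈ [m], π(u) < π(v) for every arc (u, v) of R, and π(u) ≠ π(v) for every pair of distinct vertices u, v of S that are not joined by an arc of R in either direction. -/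
/-- Let `D` be a finite transitive acyclic digraph on the vertex set `U` (transitive:
any directed path between distinct vertices is shortcut by an arc; acyclic: no directed
cycle), and define `u < v` iff there is an arc from `u` to `v`, i.e. `D u v`.  Let
`ARel` be the arc relation of a finite digraph `R` on the vertex set `S`, let
`w 0, …, w (m-1)` be distinct vertices of `S`, and let `W 0, …, W (m-1)` be pairwise
disjoint subsets of `U`.  Then the following are equivalent: (i) there is an injection
`γ : S → U` with `γ (w i) ∈ W i` for all `i` mapping every arc of `R` to an arc of `D`;
(ii) there is a function `π : S → U` with `π (w i) ∈ W i` for all `i`, with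
`π u < π v` for every arc `(u, v)` of `R`, and `π u ≠ π v` for every pair of distinct
vertices of `S` not joined by an arc of `R` in either direction. -/
theorem stmt_11 {U S : Type*} [Fintype U] [Fintype S]
    (D : U → U → Prop)
    (hacyc : ∀ x, ¬ Relation.TransGen D x x)
    (htrans : ∀ x y, x ≠ y → Relation.TransGen D x y → D x y)
    (ARel : S → S → Prop)
    (m : ℕ) (w : Fin m → S) (hw : Function.Injective w)
    (W : Fin m → Set U) (hdisj : ∀ i j, i ≠ j → Disjoint (W i) (W j)) :
    (∃ γ : S → U, Function.Injective γ ∧ (∀ i, γ (w i) ∈ W i) ∧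
        ∀ a b, ARel a b → D (γ a) (γ b)) ↔
      (∃ π : S → U, (∀ i, π (w i) ∈ W i) ∧ (∀ a b, ARel a b → D (π a) (π b)) ∧
        ∀ a b, a ≠ b → ¬ ARel a b → ¬ ARel b a → π a ≠ π b) := by
  constructor
  · rintro ⟨γ, hγ, hmem, harc⟩
    exact ⟨γ, hmem, harc, fun a b hab _ _ => hγ.ne hab⟩
  · rintro ⟨π, hmem, harc, hne⟩
    refine ⟨π, fun a b hab => ?_, hmem, harc⟩
    have irrefl : ∀ {x y}, ARel x y → π x ≠ π y := fun {x y} hxy heq => by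
      have hD := harc x y hxy
      rw [heq] at hD
      exact hacyc _ (.single hD)
    by_contra hab'
    exact hne a b hab' (fun h => irrefl h hab) (fun h => irrefl h hab.symm) hab
end

section
/- Let G be a finite graph with vertex set {g_1, …, g_l} and let H be a finite graph whose vertex set is partitioned into sets W_{H,1}, …, W_{H,l}. Let R be the oriented subdivision of G and D the oriented subdivision of H. Then the following are equivalent: (i) there exists an injection φ : V(G) → V(H) such that φ(g_i) ∈ W_{H,i} for every i ∈ [l] and φ(g_i)φ(g_j) is an edge of H for every edge g_ig_j of G; (ii) there exists an injection γ : V(R) → V(D) such that γ(g_i) ∈ W_{H,i} for every i ∈ [l] and (γ(a), γ(b)) is an arc of D for every arc (a, b) of R. -/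
/-- The oriented subdivision of an undirected graph `G`: the digraph on
`V(G) ⊕ E(G)` with an arc from a vertex `v` to an edge `e` precisely when `v` is an
endpoint of `e`, and no other arcs. -/
def osub {α : Type*} (G : SimpleGraph α) :
    (α ⊕ ↥G.edgeSet) → (α ⊕ ↥G.edgeSet) → Prop :=
  fun a b => ∃ (v : α) (e : ↥G.edgeSet),
    a = Sum.inl v ∧ b = Sum.inr e ∧ v ∈ (e : Sym2 α)

/-- Let `G` be a finite graph with vertex set `{g_1, …, g_l}` (identified with `Fin l`)
and let `H` be a finite graph whose vertex set is partitioned into sets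
`W 0, …, W (l-1)`.  Let `R` be the oriented subdivision of `G` and `D` the oriented
subdivision of `H`.  Then the following are equivalent: (i) there is an injection
`φ : V(G) → V(H)` with `φ i ∈ W i` for all `i` mapping every edge of `G` to an edge of
`H`; (ii) there is an injection `γ : V(R) → V(D)` with `γ g_i ∈ W i` for all `i`
(regarding `W i ⊆ V(H) ⊆ V(D)`) mapping every arc of `R` to an arc of `D`. -/
theorem stmt_13 {l : ℕ} {β : Type*} [Fintype β]
    (G : SimpleGraph (Fin l)) (H : SimpleGraph β)
    (W : Fin l → Set β)
    (hdisj : ∀ i j, i ≠ j → Disjoint (W i) (W j))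
    (hcov : ∀ b : β, ∃ i, b ∈ W i) :
    (∃ φ : Fin l → β, Function.Injective φ ∧ (∀ i, φ i ∈ W i) ∧
        ∀ i j, G.Adj i j → H.Adj (φ i) (φ j)) ↔
      (∃ γ : (Fin l ⊕ ↥G.edgeSet) → (β ⊕ ↥H.edgeSet), Function.Injective γ ∧
        (∀ i : Fin l, ∃ b ∈ W i, γ (Sum.inl i) = Sum.inl b) ∧
        ∀ a c, osub G a c → osub H (γ a) (γ c)) := by
  constructor
  · rintro ⟨φ, hφ, hW, hadj⟩
    let f : G →g H := ⟨φ, fun {i j} h => hadj i j h⟩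
    refine ⟨Sum.map φ f.mapEdgeSet, hφ.sumMap (SimpleGraph.Hom.mapEdgeSet.injective f hφ),
      fun i => ⟨φ i, hW i, rfl⟩, ?_⟩
    rintro _ _ ⟨v, e, rfl, rfl, hv⟩
    exact ⟨φ v, f.mapEdgeSet e, rfl, rfl, Sym2.mem_map.2 ⟨v, hv, rfl⟩⟩
  · rintro ⟨γ, hγ, hW, harc⟩
    choose φ hφW hφ using hW
    have hinj : Function.Injective φ := fun i j h =>
      Sum.inl_injective (hγ (by rw [hφ, hφ, h]))
    refine ⟨φ, hinj, hφW, fun i j hij => ?_⟩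
    obtain ⟨v, e, hv, he, hve⟩ :=
      harc _ _ ⟨i, ⟨s(i, j), hij⟩, rfl, rfl, Sym2.mem_mk_left i j⟩
    obtain ⟨w, e', hw, he', hwe⟩ :=
      harc _ _ ⟨j, ⟨s(i, j), hij⟩, rfl, rfl, Sym2.mem_mk_right i j⟩
    obtain rfl : φ i = v := Sum.inl_injective ((hφ i).symm.trans hv)
    obtain rfl : φ j = w := Sum.inl_injective ((hφ j).symm.trans hw)
    obtain rfl : e = e' := Sum.inr_injective (he.symm.trans he')
    have hs : (e : Sym2 β) = s(φ i, φ j) :=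
      (Sym2.mem_and_mem_iff (hinj.ne hij.ne)).1 ⟨hve, hwe⟩
    rw [← SimpleGraph.mem_edgeSet, ← hs]
    exact e.2
end
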